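/- Let x^(1), …, x^(k) be finite rational time series and w_1, …, w_k nonnegative rational weights, and let F_w(z) = Σ_{j=1}^k w_j · dtw(z, x^(j))². If z is any finite rational time series, then its condensation z̃ satisfies F_w(z̃) ≤ F_w(z). In particular, if there exists a time series minimizing F_w over all finite rational time series, then there exists a condensed such minimizer. -/

import Mathlib

/-- A warping path of order `m × n` (pairs are 1-indexed): it starts at `(1,1)`,
ends at `(m,n)`, stays within `[m] × [n]`, and each step is one of
`(+1,0)`, `(0,+1)`, `(+1,+1)`. -/
def IsWarpingPath (m n : ℕ) (p : List (ℕ × ℕ)) : Prop :=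
  p.head? = some (1, 1) ∧
  p.getLast? = some (m, n) ∧
  (∀ q ∈ p, 1 ≤ q.1 ∧ q.1 ≤ m ∧ 1 ≤ q.2 ∧ q.2 ≤ n) ∧
  ∀ ℓ : ℕ, ℓ + 1 < p.length →
    ((p.getD (ℓ + 1) (0, 0)).1 = (p.getD ℓ (0, 0)).1 + 1 ∧
       (p.getD (ℓ + 1) (0, 0)).2 = (p.getD ℓ (0, 0)).2) ∨
    ((p.getD (ℓ + 1) (0, 0)).1 = (p.getD ℓ (0, 0)).1 ∧
       (p.getD (ℓ + 1) (0, 0)).2 = (p.getD ℓ (0, 0)).2 + 1) ∨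
    ((p.getD (ℓ + 1) (0, 0)).1 = (p.getD ℓ (0, 0)).1 + 1 ∧
       (p.getD (ℓ + 1) (0, 0)).2 = (p.getD ℓ (0, 0)).2 + 1)

/-- The cost `C_p(x,y)` of aligning time series `x` and `y` (1-indexed, given as
lists of rationals) along the warping path `p`. -/
def alignCost (x y : List ℚ) (p : List (ℕ × ℕ)) : ℚ :=
  (p.map fun q => (x.getD (q.1 - 1) 0 - y.getD (q.2 - 1) 0) ^ 2).sum

/-- The squared dtw-distance: the minimum alignment cost over all warping paths
of order `x.length × y.length`. -/
noncomputable def dtwSq (x y : List ℚ) : ℝ :=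
  sInf {c : ℝ | ∃ p : List (ℕ × ℕ),
    IsWarpingPath x.length y.length p ∧ c = (alignCost x y p : ℝ)}

/-- The dtw-distance. -/
noncomputable def dtw (x y : List ℚ) : ℝ := Real.sqrt (dtwSq x y)

/-- A time series is condensed if no two consecutive elements are equal. -/
def IsCondensed (x : List ℚ) : Prop := x.Chain' (· ≠ ·)

/-- The condensation of a time series: repeatedly remove one of two equal
consecutive elements until the series is condensed. -/
def condense (x : List ℚ) : List ℚ := x.destutter (· ≠ ·)

/-- The weighted Fréchet function of the sample `x` with weights `w`. -/
noncomputable def frechet (k : ℕ) (x : Fin k → List ℚ) (w : Fin k → ℚ)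
    (z : List ℚ) : ℝ :=
  ∑ j : Fin k, (w j : ℝ) * dtwSq z (x j)

/-- The admissible steps of a warping path. -/
def WarpStep (a b : ℕ × ℕ) : Prop :=
  (b.1 = a.1 + 1 ∧ b.2 = a.2) ∨ (b.1 = a.1 ∧ b.2 = a.2 + 1) ∨ (b.1 = a.1 + 1 ∧ b.2 = a.2 + 1)

theorem isWarpingPath_iff {m n : ℕ} {p : List (ℕ × ℕ)} :
    IsWarpingPath m n p ↔ p.head? = some (1, 1) ∧ p.getLast? = some (m, n) ∧
      (∀ q ∈ p, 1 ≤ q.1 ∧ q.1 ≤ m ∧ 1 ≤ q.2 ∧ q.2 ≤ n) ∧ p.IsChain WarpStep := by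
  unfold IsWarpingPath
  refine and_congr_right fun _ => and_congr_right fun _ => and_congr_right fun _ => ?_
  rw [List.isChain_iff_getElem]
  refine forall_congr' fun i => forall_congr' fun hi => ?_
  rw [List.getD_eq_getElem _ _ hi, List.getD_eq_getElem _ _ (by omega : i < p.length)]
  rfl

/-- Dropping the repetitions from a chain for the reflexive closure of `R` yields a chain for `R`
with the same endpoints. -/
theorem List.IsChain.exists_sublist_of_eq_or {α : Type*} {R : α → α → Prop} {l : List α}
    (h : l.IsChain fun a b => a = b ∨ R a b) :
    ∃ l' : List α, l'.Sublist l ∧ l'.IsChain R ∧ l'.head? = l.head? ∧ l'.getLast? = l.getLast? := by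
  induction l with
  | nil => exact ⟨[], by simp⟩
  | cons a l ih =>
    cases l with
    | nil => exact ⟨[a], by simp⟩
    | cons b l =>
      rw [List.isChain_cons_cons] at h
      obtain ⟨l', hsub, hchain, hhead, hlast⟩ := ih h.2
      obtain ⟨t, rfl⟩ : ∃ t, l' = b :: t := by
        cases l' with
        | nil => simp at hhead
        | cons c t => exact ⟨t, by simpa using hhead⟩
      rcases h.1 with rfl | hab
      · exact ⟨a :: t, hsub.cons _, hchain, rfl, by simpa using hlast⟩
      · refine ⟨a :: b :: t, hsub.cons_cons _, ?_, rfl, ?_⟩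
        · exact List.isChain_cons_cons.2 ⟨hab, hchain⟩
        · simpa [List.getLast?_cons_cons] using hlast

/-- The map sending each index of a nonempty series to the index of its block in the
condensation. -/
theorem exists_index_map_destutter' {α : Type*} [DecidableEq α] (d a : α) (l : List α) :
    ∃ φ : ℕ → ℕ, φ 0 = 0 ∧ φ l.length + 1 = (l.destutter' (· ≠ ·) a).length ∧
      (∀ i, φ (i + 1) = φ i ∨ φ (i + 1) = φ i + 1) ∧
      ∀ i ≤ l.length, (a :: l).getD i d = (l.destutter' (· ≠ ·) a).getD (φ i) d := by
  induction l generalizing a with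
  | nil => exact ⟨fun _ => 0, by simp⟩
  | cons b l ih =>
    by_cases hab : a = b
    · subst hab
      obtain ⟨φ, h0, hlen, hstep, hval⟩ := ih a
      rw [List.destutter'_cons_neg _ (by simp)]
      refine ⟨fun i => φ (i - 1), h0, by simpa using hlen, ?_, ?_⟩
      · rintro (_ | i)
        · simp
        · exact hstep i
      · rintro (_ | i) hi
        · simpa using hval 0 (by simp)
        · simpa using hval i (by simpa using hi)
    · obtain ⟨φ, h0, hlen, hstep, hval⟩ := ih b
      rw [List.destutter'_cons_pos _ hab]
      refine ⟨fun i => Nat.casesOn i 0 fun j => φ j + 1, rfl, by simpa using hlen, ?_, ?_⟩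
      · rintro (_ | i)
        · simp [h0]
        · simpa using hstep i
      · rintro (_ | i) hi
        · simp
        · simpa using hval i (by simpa using hi)

theorem IsWarpingPath.snoc {m n m' n' : ℕ} {p : List (ℕ × ℕ)} (hp : IsWarpingPath m n p)
    (h : WarpStep (m, n) (m', n')) : IsWarpingPath m' n' (p ++ [(m', n')]) := by
  rw [isWarpingPath_iff] at hp ⊢
  obtain ⟨hhead, hlast, hbd, hchain⟩ := hp
  have hmn := hbd _ (List.mem_of_getLast? hlast)
  have hle : m ≤ m' ∧ n ≤ n' := by simp only [WarpStep] at h; omega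
  refine ⟨by simp [hhead], by simp, fun q hq => ?_, ?_⟩
  · rcases List.mem_append.1 hq with hq | hq
    · have := hbd q hq
      omega
    · obtain rfl := List.mem_singleton.1 hq
      dsimp only at hmn ⊢
      omega
  · rw [List.isChain_append]
    refine ⟨hchain, List.isChain_singleton _, fun a ha b hb => ?_⟩
    simp_all

theorem exists_isWarpingPath (m n : ℕ) : ∃ p, IsWarpingPath (m + 1) (n + 1) p := by
  induction m with
  | zero =>
    induction n with
    | zero => exact ⟨[(1, 1)], isWarpingPath_iff.2 (by simp)⟩
    | succ n ih =>
      obtain ⟨p, hp⟩ := ih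
      exact ⟨_, hp.snoc (Or.inr (Or.inl ⟨rfl, rfl⟩))⟩
  | succ m ih =>
    obtain ⟨p, hp⟩ := ih
    exact ⟨_, hp.snoc (Or.inl ⟨rfl, rfl⟩)⟩

theorem alignCost_nonneg (x y : List ℚ) (p : List (ℕ × ℕ)) : 0 ≤ alignCost x y p :=
  List.sum_nonneg (by simp only [List.mem_map]; rintro _ ⟨q, -, rfl⟩; positivity)

theorem alignCost_le_of_sublist (x y : List ℚ) {p p' : List (ℕ × ℕ)} (h : p'.Sublist p) :
    alignCost x y p' ≤ alignCost x y p := by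
  refine (h.map _).sum_le_sum ?_
  simp only [List.mem_map]
  rintro _ ⟨q, -, rfl⟩
  positivity

theorem condense_ne_nil {z : List ℚ} (hz : z ≠ []) : condense z ≠ [] := by
  simpa [condense, List.destutter_eq_nil] using hz

/-- Every warping path for `z` induces one for the condensation of `z` of no larger cost. -/
theorem exists_isWarpingPath_condense {z x : List ℚ} {p : List (ℕ × ℕ)}
    (hp : IsWarpingPath z.length x.length p) :
    ∃ p', IsWarpingPath (condense z).length x.length p' ∧
      alignCost (condense z) x p' ≤ alignCost z x p := by
  cases z with
  | nil => exact ⟨p, hp, le_rfl⟩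
  | cons a l =>
    obtain ⟨φ, h0, hlen, hstep, hval⟩ := exists_index_map_destutter' 0 a l
    change φ l.length + 1 = (condense (a :: l)).length at hlen
    change ∀ i ≤ l.length, (a :: l).getD i 0 = (condense (a :: l)).getD (φ i) 0 at hval
    have hmono : Monotone φ := monotone_nat_of_le_succ fun i => by
      rcases hstep i with h | h <;> omega
    rw [isWarpingPath_iff] at hp
    obtain ⟨hhead, hlast, hbd, hchain⟩ := hp
    let f : ℕ × ℕ → ℕ × ℕ := fun q => (φ (q.1 - 1) + 1, q.2)
    have hchain' : (p.map f).IsChain fun a b => a = b ∨ WarpStep a b := by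
      rw [List.isChain_map]
      refine List.IsChain.imp_of_mem_imp (fun q r hq _ h => ?_) hchain
      obtain ⟨i, hi⟩ : ∃ i, q.1 = i + 1 := ⟨q.1 - 1, by have := (hbd q hq).1; omega⟩
      have := hstep i
      rcases h with ⟨h1, h2⟩ | ⟨h1, h2⟩ | ⟨h1, h2⟩ <;>
        simp only [f, WarpStep, h1, h2, hi, Prod.ext_iff, Nat.add_sub_cancel] <;> grind
    obtain ⟨p', hsub, hp', hhead', hlast'⟩ := hchain'.exists_sublist_of_eq_or
    refine ⟨p', isWarpingPath_iff.2 ⟨?_, ?_, fun q hq => ?_, hp'⟩, ?_⟩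
    · simp [hhead', hhead, f, h0]
    · simp [hlast', hlast, f, ← hlen]
    · obtain ⟨r, hr, rfl⟩ := List.mem_map.1 (hsub.subset hq)
      have hb := hbd r hr
      rw [List.length_cons] at hb
      have := hmono (show r.1 - 1 ≤ l.length by omega)
      simp only [f]
      omega
    · refine (alignCost_le_of_sublist _ _ hsub).trans_eq ?_
      unfold alignCost
      rw [List.map_map]
      refine congrArg List.sum (List.map_congr_left fun q hq => ?_)
      have hb := hbd q hq
      rw [List.length_cons] at hb
      rw [hval (q.1 - 1) (by omega)]
      rfl

theorem dtwSq_condense_le (z x : List ℚ) : dtwSq (condense z) x ≤ dtwSq z x := by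
  rcases eq_or_ne z [] with rfl | hz
  · exact le_rfl
  rcases eq_or_ne x [] with rfl | hx
  · have hempty (y : List ℚ) : dtwSq y [] = 0 := by
      have : {c : ℝ | ∃ p, IsWarpingPath y.length ([] : List ℚ).length p ∧
          c = (alignCost y [] p : ℝ)} = ∅ := by
        refine Set.eq_empty_of_forall_notMem ?_
        rintro _ ⟨p, hp, -⟩
        have := hp.2.2.1 _ (List.mem_of_getLast? hp.2.1)
        simp at this
      rw [dtwSq, this, Real.sInf_empty]
    rw [hempty, hempty]
  · have hne : ∃ p, IsWarpingPath z.length x.length p := by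
      obtain ⟨m, hm⟩ := Nat.exists_eq_succ_of_ne_zero (mt List.length_eq_zero_iff.1 hz)
      obtain ⟨n, hn⟩ := Nat.exists_eq_succ_of_ne_zero (mt List.length_eq_zero_iff.1 hx)
      rw [hm, hn]
      exact exists_isWarpingPath m n
    obtain ⟨p₀, hp₀⟩ := hne
    refine le_csInf ⟨_, p₀, hp₀, rfl⟩ ?_
    rintro _ ⟨p, hp, rfl⟩
    obtain ⟨p', hp', hle⟩ := exists_isWarpingPath_condense hp
    have hcast : (alignCost (condense z) x p' : ℝ) ≤ alignCost z x p := Rat.cast_le.2 hle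
    refine le_trans (csInf_le ⟨0, ?_⟩ ⟨p', hp', rfl⟩) hcast
    rintro _ ⟨q, -, rfl⟩
    exact Rat.cast_nonneg.2 (alignCost_nonneg _ _ _)

/-- Condensing a time series does not increase the weighted Fréchet function;
in particular, if a minimizer of the weighted Fréchet function over all finite
rational time series exists, then a condensed minimizer exists. -/
theorem frechet_condense_le (k : ℕ) (x : Fin k → List ℚ) (w : Fin k → ℚ)
    (hw : ∀ j, 0 ≤ w j) :
    (∀ z : List ℚ, frechet k x w (condense z) ≤ frechet k x w z) ∧
    ((∃ z : List ℚ, z ≠ [] ∧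
        ∀ z' : List ℚ, z' ≠ [] → frechet k x w z ≤ frechet k x w z') →
      ∃ z : List ℚ, z ≠ [] ∧ IsCondensed z ∧
        ∀ z' : List ℚ, z' ≠ [] → frechet k x w z ≤ frechet k x w z') := by
  have hle (z : List ℚ) : frechet k x w (condense z) ≤ frechet k x w z :=
    Finset.sum_le_sum fun j _ =>
      mul_le_mul_of_nonneg_left (dtwSq_condense_le z (x j)) (Rat.cast_nonneg.2 (hw j))
  refine ⟨hle, ?_⟩
  rintro ⟨z, hz, hmin⟩
  exact ⟨condense z, condense_ne_nil hz, List.isChain_destutter _ z,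
    fun z' hz' => (hle z).trans (hmin z' hz')⟩
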